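/- arXiv:1204.6361 — 2 statements merged into one kernel-verified Lean document; each statement's English description precedes it below -/
import Mathlib

section
/- For every integer m ≥ 4, there are exactly two integers n with 7 ≤ n < 7 + 2^m such that the function j ↦ ν₂(S(j,7)) is non-constant on [n]_{2^m}; moreover, for every m ≥ 4, whenever j ↦ ν₂(S(j,7)) is non-constant on a class [n]_{2^m}, it is non-constant on exactly one of the two children [n]_{2^(m+1)} and [n + 2^m]_{2^(m+1)}. In particular, N_{7,1} = {7,8}, N_{7,2} = {9,10}, N_{7,3} = {13,14}, and N_{7,4} = {13,14}. -/
/-- Stirling numbers of the second kind, via the standard recurrence. -/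
def stirling2 : ℕ → ℕ → ℕ
  | 0, 0 => 1
  | 0, _ + 1 => 0
  | _ + 1, 0 => 0
  | n + 1, k + 1 => (k + 1) * stirling2 n (k + 1) + stirling2 n k

/-- The congruence class `[n]_t = { j : j ≥ max(n,t) and j ≡ n (mod t) }`. -/
def cls (n t : ℕ) : Set ℕ := {j | max n t ≤ j ∧ j ≡ n [MOD t]}

/-- `b_k = ⌈log₂ k⌉ - 2`. -/
def bk (k : ℕ) : ℕ := Nat.clog 2 k - 2

/-- A set of naturals is constant modulo `M`. -/
def ConstMod (M : ℕ) (A : Set ℕ) : Prop := ∀ a ∈ A, ∀ b ∈ A, a ≡ b [MOD M]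

/-- The image set `S([n]_{2^m}, k)`. -/
def Scls (k n m : ℕ) : Set ℕ := (fun j => stirling2 j k) '' cls n (2 ^ m)

/-- The function `j ↦ ν₂(S(j,k))` is constant on the set `A`. -/
def ValConstOn (k : ℕ) (A : Set ℕ) : Prop :=
  ∀ i ∈ A, ∀ j ∈ A, padicValNat 2 (stirling2 i k) = padicValNat 2 (stirling2 j k)

/-- `N_{k,m}`: the set of `n` with `k ≤ n < k + 2^m` on which `ν₂ ∘ S(·,k)`
is non-constant on `[n]_{2^m}`. -/
def Nkm (k m : ℕ) : Set ℕ :=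
  {n | k ≤ n ∧ n < k + 2 ^ m ∧ ¬ ValConstOn k (cls n (2 ^ m))}

/-- The part of the numerator of `7! * S(j,7)` coming from the odd bases. -/
def oddPart (j : ℕ) : ℕ := 7 ^ j + 21 * 5 ^ j + 35 * 3 ^ j + 7

/-- The excess of the 2-adic valuation of `oddPart (j + 2 ^ m) - oddPart j` over `m`. -/
def excess (j : ℕ) : ℕ := if j % 2 = 0 then 5 else 3

/-- The closed form of `S(n,k)` for `k ≤ 7`, with the negative terms moved to the left. -/
theorem stirling2_closed_forms (n : ℕ) :
    stirling2 (n + 1) 0 = 0 ∧ stirling2 (n + 1) 1 = 1 ∧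
    2 * stirling2 (n + 1) 2 + 2 = 2 ^ (n + 1) ∧
    6 * stirling2 (n + 1) 3 + 3 * 2 ^ (n + 1) = 3 ^ (n + 1) + 3 ∧
    24 * stirling2 (n + 1) 4 + 4 * 3 ^ (n + 1) + 4 = 4 ^ (n + 1) + 6 * 2 ^ (n + 1) ∧
    120 * stirling2 (n + 1) 5 + 5 * 4 ^ (n + 1) + 10 * 2 ^ (n + 1) =
      5 ^ (n + 1) + 10 * 3 ^ (n + 1) + 5 ∧
    720 * stirling2 (n + 1) 6 + 6 * 5 ^ (n + 1) + 20 * 3 ^ (n + 1) + 6 =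
      6 ^ (n + 1) + 15 * 4 ^ (n + 1) + 15 * 2 ^ (n + 1) ∧
    5040 * stirling2 (n + 1) 7 + (7 * 6 ^ (n + 1) + 35 * 4 ^ (n + 1) + 21 * 2 ^ (n + 1)) =
      oddPart (n + 1) := by
  unfold oddPart
  induction n with
  | zero => simp [stirling2]
  | succ n ih =>
    obtain ⟨h0, h1, h2, h3, h4, h5, h6, h7⟩ := ih
    have rec_succ (k : ℕ) : stirling2 (n + 1 + 1) (k + 1) =
      (k + 1) * stirling2 (n + 1) (k + 1) + stirling2 (n + 1) k := rfl
    have r0 : stirling2 (n + 1 + 1) 0 = 0 := rfl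
    rw [r0, rec_succ 0, rec_succ 1, rec_succ 2, rec_succ 3, rec_succ 4, rec_succ 5, rec_succ 6]
    simp only [pow_succ _ (n + 1)]
    norm_num
    refine ⟨?_, ?_, ?_, ?_, ?_, ?_, ?_⟩ <;> omega

theorem stirling2_seven_closed_form {j : ℕ} (hj : 1 ≤ j) :
    5040 * stirling2 j 7 + (7 * 6 ^ j + 35 * 4 ^ j + 21 * 2 ^ j) = oddPart j := by
  obtain ⟨n, rfl⟩ := Nat.exists_eq_add_of_le' hj
  exact (stirling2_closed_forms n).2.2.2.2.2.2.2

theorem stirling2_pos {n k : ℕ} (hk : 1 ≤ k) (hkn : k ≤ n) : 0 < stirling2 n k := by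
  induction n generalizing k with
  | zero => omega
  | succ n ih =>
    obtain ⟨k, rfl⟩ := Nat.exists_eq_add_of_le' hk
    simp only [stirling2]
    rcases Nat.lt_or_ge k 1 with h | h
    · obtain rfl : k = 0 := by omega
      rcases Nat.eq_zero_or_pos n with rfl | hn
      · simp [stirling2]
      · have := ih (k := 1) le_rfl hn
        simp only [Nat.zero_add]
        omega
    · have := ih (k := k) h (by omega)
      omega

theorem two_pow_dvd_stirling2_seven_iff {i j : ℕ} (hij : i + 4 ≤ j) :
    2 ^ i ∣ stirling2 j 7 ↔ 2 ^ (i + 4) ∣ oddPart j := by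
  have dvd_pow_even (c : ℕ) : 2 ^ (i + 4) ∣ (2 * c) ^ j :=
    (pow_dvd_pow 2 hij).trans (mul_pow 2 c j ▸ dvd_mul_right _ _)
  have heven : 2 ^ (i + 4) ∣ 7 * 6 ^ j + 35 * 4 ^ j + 21 * 2 ^ j :=
    dvd_add (dvd_add ((dvd_pow_even 3).mul_left _) ((dvd_pow_even 2).mul_left _))
      ((dvd_pow_even 1).mul_left _)
  rw [← stirling2_seven_closed_form (by omega), Nat.dvd_add_left heven,
    show 5040 * stirling2 j 7 = (315 * stirling2 j 7) * 2 ^ 4 by ring, pow_add,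
    Nat.mul_dvd_mul_iff_right (by norm_num)]
  exact (Nat.Coprime.dvd_mul_left (Nat.Coprime.pow_left i (by norm_num))).symm

theorem pow_two_pow_eq {x c : ℕ} (hx : ∃ u, x ^ 2 ^ 4 = 1 + 2 ^ 6 * u ∧ u % 16 = c) {m : ℕ}
    (hm : 4 ≤ m) : ∃ u, x ^ 2 ^ m = 1 + 2 ^ (m + 2) * u ∧ u % 16 = c := by
  induction m, hm using Nat.le_induction with
  | base => exact hx
  | succ m hm ih =>
    obtain ⟨u, hu, huc⟩ := ih
    refine ⟨u + 2 ^ (m + 1) * u ^ 2, by rw [pow_succ 2 m, pow_mul, hu]; ring, ?_⟩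
    obtain ⟨t, rfl⟩ := Nat.exists_eq_add_of_le hm
    rw [show 2 ^ (4 + t + 1) * u ^ 2 = 16 * (2 * 2 ^ t * u ^ 2) by ring]
    omega

theorem excess_eq_of_mod_two {a b : ℕ} (h : a % 2 = b % 2) : excess a = excess b := by
  simp [excess, h]

theorem oddPart_add_two_pow {m : ℕ} (hm : 4 ≤ m) (j : ℕ) :
    ∃ w, w % 2 = 1 ∧ oddPart (j + 2 ^ m) = oddPart j + 2 ^ (m + excess j) * w := by
  obtain ⟨u, hu, hu'⟩ := pow_two_pow_eq (x := 7) (c := 6) ⟨519264540150, by norm_num⟩ hm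
  obtain ⟨v, hv, hv'⟩ := pow_two_pow_eq (x := 5) (c := 15) ⟨2384185791, by norm_num⟩ hm
  obtain ⟨w, hw, hw'⟩ := pow_two_pow_eq (x := 3) (c := 13) ⟨672605, by norm_num⟩ hm
  set E := 7 ^ j * u + 21 * (5 ^ j * v) + 35 * (3 ^ j * w) with hE
  have hsum : oddPart (j + 2 ^ m) = oddPart j + 2 ^ (m + 2) * E := by
    simp only [oddPart, pow_add _ j, hu, hv, hw, hE]
    ring
  have hEmod : E % 16 = (7 ^ (j % 4) * 6 + 21 * (5 ^ (j % 4) * 15) +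
      35 * (3 ^ (j % 4) * 13)) % 16 := by
    have periodic (x : ℕ) (hx : x ^ 4 ≡ 1 [MOD 16]) : x ^ j ≡ x ^ (j % 4) [MOD 16] := by
      conv_lhs => rw [← Nat.div_add_mod j 4, pow_add, pow_mul]
      simpa only [one_pow, one_mul] using (hx.pow (j / 4)).mul_right (x ^ (j % 4))
    have hu16 : u ≡ 6 [MOD 16] := hu'
    have hv16 : v ≡ 15 [MOD 16] := hv'
    have hw16 : w ≡ 13 [MOD 16] := hw'
    exact (((periodic 7 rfl).mul hu16).add (((periodic 5 rfl).mul hv16).mul_left 21)).add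
      (((periodic 3 rfl).mul hw16).mul_left 35)
  by_cases hj : j % 2 = 0
  · have h8 : E % 16 = 8 := by
      have : j % 4 = 0 ∨ j % 4 = 2 := by omega
      rcases this with h | h <;> rw [hEmod, h] <;> rfl
    obtain ⟨q, hq⟩ : ∃ q, E = 8 * q := ⟨E / 8, by omega⟩
    refine ⟨q, by omega, ?_⟩
    rw [hsum, excess, if_pos hj, hq]
    ring
  · have h2 : E % 4 = 2 := by
      have : j % 4 = 1 ∨ j % 4 = 3 := by omega
      rcases this with h | h <;> · rw [h] at hEmod; norm_num at hEmod; omega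
    obtain ⟨q, hq⟩ : ∃ q, E = 2 * q := ⟨E / 2, by omega⟩
    refine ⟨q, by omega, ?_⟩
    rw [hsum, excess, if_neg hj, hq]
    ring

theorem mod_two_eq_of_modEq_two_pow {m a b : ℕ} (hm : 4 ≤ m) (h : a ≡ b [MOD 2 ^ m]) :
    a % 2 = b % 2 :=
  h.of_dvd (dvd_pow_self 2 (by omega))

theorem excess_add_two_pow {m : ℕ} (hm : 4 ≤ m) (n : ℕ) : excess (n + 2 ^ m) = excess n :=
  excess_eq_of_mod_two (mod_two_eq_of_modEq_two_pow hm (by simp [Nat.ModEq]))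

theorem oddPart_modEq {m a b : ℕ} (hm : 4 ≤ m) (h : a ≡ b [MOD 2 ^ m]) :
    oddPart a ≡ oddPart b [MOD 2 ^ (m + excess a)] := by
  wlog hab : a ≤ b generalizing a b
  · rw [excess_eq_of_mod_two (mod_two_eq_of_modEq_two_pow hm h)]
    exact (this h.symm (by omega)).symm
  obtain ⟨t, ht⟩ := (Nat.modEq_iff_dvd' hab).1 h
  obtain rfl : b = a + 2 ^ m * t := by omega
  clear hab h ht
  induction t with
  | zero => simp [Nat.ModEq]
  | succ t ih =>
    obtain ⟨w, -, hw⟩ := oddPart_add_two_pow hm (a + 2 ^ m * t)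
    have he : excess (a + 2 ^ m * t) = excess a :=
      excess_eq_of_mod_two (mod_two_eq_of_modEq_two_pow hm (by simp [Nat.ModEq]))
    rw [show a + 2 ^ m * (t + 1) = a + 2 ^ m * t + 2 ^ m by ring, hw, he]
    refine ih.trans ?_
    simp [Nat.ModEq]

theorem two_pow_dvd_oddPart_congr {i m a b : ℕ} (hm : 4 ≤ m) (h : a ≡ b [MOD 2 ^ m])
    (hi : i ≤ m + excess a) : 2 ^ i ∣ oddPart a ↔ 2 ^ i ∣ oddPart b :=
  ((oddPart_modEq hm h).of_dvd (pow_dvd_pow 2 hi)).dvd_iff dvd_rfl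

theorem excess_le (n : ℕ) : excess n ≤ 5 := by unfold excess; split <;> omega

theorem three_le_excess (n : ℕ) : 3 ≤ excess n := by unfold excess; split <;> omega

/-- The numbers `n` whose class `[n]_{2^m}` turns out to be non-constant, for `m ≥ 4`. -/
def Critical (m n : ℕ) : Prop := 2 ^ (m + excess n) ∣ oddPart n

theorem Critical.congr {m a b : ℕ} (hm : 4 ≤ m) (h : a ≡ b [MOD 2 ^ m]) :
    Critical m a ↔ Critical m b := by
  unfold Critical
  rw [← excess_eq_of_mod_two (mod_two_eq_of_modEq_two_pow hm h)]
  exact two_pow_dvd_oddPart_congr hm h le_rfl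

theorem Critical.of_succ {m n : ℕ} (h : Critical (m + 1) n) : Critical m n :=
  (pow_dvd_pow 2 (by omega)).trans h

theorem Critical.xor_children {m n : ℕ} (hm : 4 ≤ m) (h : Critical m n) :
    Xor (Critical (m + 1) n) (Critical (m + 1) (n + 2 ^ m)) := by
  obtain ⟨g, hg⟩ := h
  obtain ⟨w, hw, hG⟩ := oddPart_add_two_pow hm n
  have dvd_iff (x : ℕ) : 2 ^ (m + 1 + excess n) ∣ 2 ^ (m + excess n) * x ↔ 2 ∣ x := by
    rw [show m + 1 + excess n = (m + excess n) + 1 by ring, pow_succ]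
    exact Nat.mul_dvd_mul_iff_left (by positivity)
  unfold Critical
  rw [excess_add_two_pow hm, hG, hg, ← mul_add, dvd_iff, dvd_iff, xor_iff_iff_not]
  omega

theorem critical_four_iff (n : ℕ) : Critical 4 n ↔ n % 16 = 13 ∨ n % 16 = 14 := by
  rw [← Critical.congr le_rfl (Nat.mod_modEq n (2 ^ 4))]
  have hlt : n % 2 ^ 4 < 16 := Nat.mod_lt _ (by norm_num)
  change _ ↔ n % 2 ^ 4 = 13 ∨ n % 2 ^ 4 = 14
  unfold Critical
  revert hlt
  generalize n % 2 ^ 4 = r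
  intro hlt
  interval_cases r <;> decide

theorem seven_add_le_two_pow {m : ℕ} (hm : 4 ≤ m) : m + 7 ≤ 2 ^ m := by
  induction m, hm using Nat.le_induction with
  | base => norm_num
  | succ m hm ih => rw [pow_succ]; omega

theorem padicValNat_le_of_dvd_imp {p a b N : ℕ} [Fact p.Prime] (ha : a ≠ 0) (hb : b ≠ 0)
    (haN : ¬ p ^ N ∣ a) (h : ∀ i ≤ N, p ^ i ∣ a → p ^ i ∣ b) :
    padicValNat p a ≤ padicValNat p b := by
  have hlt : padicValNat p a < N := by
    rw [padicValNat_dvd_iff_le ha] at haN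
    omega
  exact (padicValNat_dvd_iff_le hb).1 (h _ hlt.le pow_padicValNat_dvd)

theorem not_valConstOn_cls_iff {m : ℕ} (hm : 4 ≤ m) (n : ℕ) :
    ¬ ValConstOn 7 (cls n (2 ^ m)) ↔ Critical m n := by
  have hpow := seven_add_le_two_pow hm
  have he5 := excess_le n
  have he3 := three_le_excess n
  have ne_zero {j : ℕ} (hj : 2 ^ m ≤ j) : stirling2 j 7 ≠ 0 :=
    (stirling2_pos (by omega) (by omega)).ne'
  constructor
  · contrapose!
    intro h
    have val_le : ∀ a ∈ cls n (2 ^ m), ∀ b ∈ cls n (2 ^ m),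
        padicValNat 2 (stirling2 a 7) ≤ padicValNat 2 (stirling2 b 7) := by
      rintro a ⟨ha, han⟩ b ⟨hb, hbn⟩
      have ha' := (le_max_right _ _).trans ha
      have hb' := (le_max_right _ _).trans hb
      have hea := excess_eq_of_mod_two (mod_two_eq_of_modEq_two_pow hm han)
      refine padicValNat_le_of_dvd_imp (N := m + excess n - 4) (ne_zero ha') (ne_zero hb') ?_ ?_
      · rw [two_pow_dvd_stirling2_seven_iff (by omega),
          show m + excess n - 4 + 4 = m + excess a by omega]
        exact fun hdvd => h ((Critical.congr hm han).1 hdvd)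
      · intro i hi
        rw [two_pow_dvd_stirling2_seven_iff (by omega), two_pow_dvd_stirling2_seven_iff (by omega),
          two_pow_dvd_oddPart_congr hm (han.trans hbn.symm) (by omega)]
        exact id
    exact fun a ha b hb => le_antisymm (val_le a ha b hb) (val_le b hb a ha)
  · intro h hconst
    have modEq_self_add (x : ℕ) : x + 2 ^ m ≡ x [MOD 2 ^ m] := by simp [Nat.ModEq]
    have dvd_iff (j : ℕ) (hj : 2 ^ m ≤ j) (hjn : j ≡ n [MOD 2 ^ m]) :
        m + excess n - 3 ≤ padicValNat 2 (stirling2 j 7) ↔ Critical (m + 1) j := by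
      have hej := excess_eq_of_mod_two (mod_two_eq_of_modEq_two_pow hm hjn)
      rw [← padicValNat_dvd_iff_le (ne_zero hj), two_pow_dvd_stirling2_seven_iff (by omega),
        Critical, hej, show m + excess n - 3 + 4 = m + 1 + excess n by omega]
    have hmem : n + 2 ^ m ∈ cls n (2 ^ m) := ⟨by omega, modEq_self_add n⟩
    have hmem' : n + 2 ^ m + 2 ^ m ∈ cls n (2 ^ m) :=
      ⟨by omega, (modEq_self_add _).trans (modEq_self_add n)⟩
    have hxor := Critical.xor_children hm ((Critical.congr hm (modEq_self_add n)).2 h)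
    rw [← dvd_iff _ (by omega) hmem.2, ← dvd_iff _ (by omega) hmem'.2, hconst _ hmem _ hmem',
      xor_self] at hxor
    exact hxor

theorem Nat.ModEq.two_pow_succ_of_two_pow {m a b : ℕ} (h : a ≡ b [MOD 2 ^ m]) :
    a ≡ b [MOD 2 ^ (m + 1)] ∨ a ≡ b + 2 ^ m [MOD 2 ^ (m + 1)] := by
  obtain ⟨t, ht⟩ := (Nat.modEq_iff_dvd.1 h)
  rcases Int.even_or_odd' t with ⟨s, rfl | rfl⟩
  · refine Or.inl (Nat.modEq_iff_dvd.2 ⟨s, ?_⟩)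
    rw [ht]; push_cast; ring
  · refine Or.inr (Nat.modEq_iff_dvd.2 ⟨s + 1, ?_⟩)
    push_cast at ht ⊢
    linear_combination ht

theorem exists_critical_child {m a : ℕ} (hm : 4 ≤ m) (ha : Critical m a) :
    ∃ a', (a' = a ∨ a' = a + 2 ^ m) ∧
      ∀ n, n ≡ a [MOD 2 ^ m] → (Critical (m + 1) n ↔ n ≡ a' [MOD 2 ^ (m + 1)]) := by
  have hm' : 4 ≤ m + 1 := by omega
  have key {c d : ℕ} (hc : Critical (m + 1) c) (hd : ¬ Critical (m + 1) d) {n : ℕ}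
      (h : n ≡ c [MOD 2 ^ (m + 1)] ∨ n ≡ d [MOD 2 ^ (m + 1)]) :
      Critical (m + 1) n ↔ n ≡ c [MOD 2 ^ (m + 1)] := by
    refine ⟨fun hn => h.resolve_right fun hnd => hd ((Critical.congr hm' hnd).1 hn),
      fun hn => (Critical.congr hm' hn).2 hc⟩
  rcases Critical.xor_children hm ha with ⟨h1, h2⟩ | ⟨h1, h2⟩
  · exact ⟨a, Or.inl rfl, fun n hn => key h1 h2 hn.two_pow_succ_of_two_pow⟩
  · exact ⟨a + 2 ^ m, Or.inr rfl, fun n hn => key h1 h2 hn.two_pow_succ_of_two_pow.symm⟩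

theorem exists_critical_iff {m : ℕ} (hm : 4 ≤ m) :
    ∃ a b, 7 ≤ a ∧ a < 7 + 2 ^ m ∧ 7 ≤ b ∧ b < 7 + 2 ^ m ∧ ¬ a ≡ b [MOD 2 ^ m] ∧
      ∀ n, Critical m n ↔ n ≡ a [MOD 2 ^ m] ∨ n ≡ b [MOD 2 ^ m] := by
  induction m, hm using Nat.le_induction with
  | base => exact ⟨13, 14, by norm_num, by norm_num, by norm_num, by norm_num, by decide,
      critical_four_iff⟩
  | succ m hm ih =>
    obtain ⟨a, b, ha, ha', hb, hb', hab, hcrit⟩ := ih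
    obtain ⟨c, hc, hc'⟩ := exists_critical_child hm ((hcrit a).2 (Or.inl rfl))
    obtain ⟨d, hd, hd'⟩ := exists_critical_child hm ((hcrit b).2 (Or.inr rfl))
    have hca : c ≡ a [MOD 2 ^ m] := by rcases hc with rfl | rfl <;> simp [Nat.ModEq]
    have hdb : d ≡ b [MOD 2 ^ m] := by rcases hd with rfl | rfl <;> simp [Nat.ModEq]
    have hdvd : 2 ^ m ∣ 2 ^ (m + 1) := pow_dvd_pow 2 (by omega)
    have hpow : 2 ^ (m + 1) = 2 ^ m * 2 := pow_succ 2 m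
    refine ⟨c, d, by omega, by omega, by omega, by omega,
      fun h => hab ((hca.symm.trans (h.of_dvd hdvd)).trans hdb), fun n => ⟨fun hn => ?_, ?_⟩⟩
    · exact ((hcrit n).1 hn.of_succ).imp (fun h => (hc' n h).1 hn) (fun h => (hd' n h).1 hn)
    · rintro (h | h)
      · exact (hc' n ((h.of_dvd hdvd).trans hca)).2 h
      · exact (hd' n ((h.of_dvd hdvd).trans hdb)).2 h

theorem eq_of_modEq_of_mem_window {k M a b : ℕ} (ha : k ≤ a) (ha' : a < k + M) (hb : k ≤ b)
    (hb' : b < k + M) (h : a ≡ b [MOD M]) : a = b := by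
  rw [← Nat.add_sub_cancel' ha, ← Nat.add_sub_cancel' hb] at h ⊢
  rw [Nat.ModEq.eq_of_lt_of_lt (Nat.ModEq.add_left_cancel' k h) (by omega) (by omega)]

theorem ncard_Nkm_seven {m : ℕ} (hm : 4 ≤ m) : (Nkm 7 m).ncard = 2 := by
  obtain ⟨a, b, ha, ha', hb, hb', hab, hcrit⟩ := exists_critical_iff hm
  have heq : Nkm 7 m = {a, b} := by
    ext n
    simp only [Nkm, Set.mem_ofPred_eq, not_valConstOn_cls_iff hm, hcrit, Set.mem_insert_iff,
      Set.mem_singleton_iff]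
    constructor
    · rintro ⟨h1, h2, h⟩
      exact h.imp (eq_of_modEq_of_mem_window h1 h2 ha ha') (eq_of_modEq_of_mem_window h1 h2 hb hb')
    · rintro (rfl | rfl)
      · exact ⟨ha, ha', Or.inl rfl⟩
      · exact ⟨hb, hb', Or.inr rfl⟩
  rw [heq, Set.ncard_pair]
  rintro rfl
  exact hab rfl

/-- The valuation of `S(j,7)` for `j ≡ r (mod 16)`, when `r` is neither `13` nor `14`. -/
def residueVal (r : ℕ) : ℕ := [2, 1, 3, 0, 2, 2, 4, 0, 2, 1, 3, 0, 2, 0, 0, 0].getD r 0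

theorem padicValNat_eq_of_dvd_of_not_dvd {p a t : ℕ} [Fact p.Prime] (h : p ^ t ∣ a)
    (h' : ¬ p ^ (t + 1) ∣ a) : padicValNat p a = t := by
  have ha : a ≠ 0 := by rintro rfl; exact h' (dvd_zero _)
  rw [padicValNat_dvd_iff_le ha] at h h'
  omega

theorem residueVal_spec {r : ℕ} (hr : r < 16) (h13 : r ≠ 13) (h14 : r ≠ 14) :
    residueVal r + 5 ≤ 4 + excess r ∧ 2 ^ (residueVal r + 4) ∣ oddPart r ∧
      ¬ 2 ^ (residueVal r + 5) ∣ oddPart r := by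
  interval_cases r <;> first | omega | decide

theorem padicValNat_stirling2_seven {j : ℕ} (hj : 7 ≤ j) (h13 : j % 16 ≠ 13)
    (h14 : j % 16 ≠ 14) : padicValNat 2 (stirling2 j 7) = residueVal (j % 16) := by
  rcases (by omega : j = 7 ∨ j = 8 ∨ 9 ≤ j) with rfl | rfl | h9
  · exact padicValNat_eq_of_dvd_of_not_dvd (by decide) (by decide)
  · exact padicValNat_eq_of_dvd_of_not_dvd (by decide) (by decide)
  · obtain ⟨hle, hdvd, hndvd⟩ := residueVal_spec (Nat.mod_lt j (by norm_num)) h13 h14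
    have hmod : j % 16 ≡ j [MOD 2 ^ 4] := Nat.mod_modEq j 16
    have he := excess_le (j % 16)
    apply padicValNat_eq_of_dvd_of_not_dvd
    · rw [two_pow_dvd_stirling2_seven_iff (by omega)]
      exact (two_pow_dvd_oddPart_congr le_rfl hmod (by omega)).1 hdvd
    · rw [two_pow_dvd_stirling2_seven_iff (by omega)]
      exact fun h => hndvd ((two_pow_dvd_oddPart_congr le_rfl hmod (by omega)).2 h)

theorem valConstOn_cls_of_residueVal {n t c : ℕ} (hn : 7 ≤ n) (ht : t ∣ 16)
    (h : ∀ r < 16, r % t = n % t → r ≠ 13 ∧ r ≠ 14 ∧ residueVal r = c) :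
    ValConstOn 7 (cls n t) := by
  have val_eq : ∀ j ∈ cls n t, padicValNat 2 (stirling2 j 7) = c := by
    rintro j ⟨hj, hjn⟩
    obtain ⟨h13, h14, hc⟩ := h (j % 16) (Nat.mod_lt j (by norm_num))
      ((Nat.mod_mod_of_dvd j ht).trans hjn)
    rw [padicValNat_stirling2_seven (by omega) h13 h14, hc]
  exact fun a ha b hb => (val_eq a ha).trans (val_eq b hb).symm

theorem not_valConstOn_of_residueVal {A : Set ℕ} {a b : ℕ} (ha : a ∈ A) (hb : b ∈ A)
    (h : 7 ≤ a ∧ a % 16 ≠ 13 ∧ a % 16 ≠ 14 ∧ 7 ≤ b ∧ b % 16 ≠ 13 ∧ b % 16 ≠ 14 ∧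
      residueVal (a % 16) ≠ residueVal (b % 16)) : ¬ ValConstOn 7 A := by
  obtain ⟨h1, h2, h3, h4, h5, h6, h7⟩ := h
  intro hconst
  have := hconst a ha b hb
  rw [padicValNat_stirling2_seven h1 h2 h3, padicValNat_stirling2_seven h4 h5 h6] at this
  exact h7 this

theorem not_valConstOn_of_dvd {A : Set ℕ} {a b t : ℕ} (ha : a ∈ A) (hb : b ∈ A)
    (h : 7 ≤ a ∧ a % 16 ≠ 13 ∧ a % 16 ≠ 14 ∧ residueVal (a % 16) < t ∧ 7 ≤ b ∧ t + 4 ≤ b ∧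
      2 ^ (t + 4) ∣ oddPart b) : ¬ ValConstOn 7 A := by
  obtain ⟨h1, h2, h3, h4, h7, h5, h6⟩ := h
  intro hconst
  have := hconst a ha b hb
  rw [padicValNat_stirling2_seven h1 h2 h3] at this
  rw [← two_pow_dvd_stirling2_seven_iff h5,
    padicValNat_dvd_iff_le (stirling2_pos (by norm_num) h7).ne'] at h6
  omega

theorem mem_cls_iff {n t j : ℕ} : j ∈ cls n t ↔ max n t ≤ j ∧ j ≡ n [MOD t] := Iff.rfl

theorem Nkm_seven_one : Nkm 7 1 = {7, 8} := by
  ext n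
  simp only [Nkm, Set.mem_ofPred_eq, Set.mem_insert_iff, Set.mem_singleton_iff]
  refine ⟨fun ⟨h1, h2, _⟩ => by omega, ?_⟩
  rintro (rfl | rfl) <;> refine ⟨by norm_num, by norm_num, ?_⟩
  · exact not_valConstOn_of_residueVal (a := 7) (b := 9) (mem_cls_iff.2 (by decide))
      (mem_cls_iff.2 (by decide)) (by decide)
  · exact not_valConstOn_of_residueVal (a := 8) (b := 10) (mem_cls_iff.2 (by decide))
      (mem_cls_iff.2 (by decide)) (by decide)

theorem Nkm_seven_two : Nkm 7 2 = {9, 10} := by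
  ext n
  simp only [Nkm, Set.mem_ofPred_eq, Set.mem_insert_iff, Set.mem_singleton_iff]
  constructor
  · rintro ⟨h1, h2, h⟩
    by_contra hne
    rcases (by omega : n = 7 ∨ n = 8) with rfl | rfl
    · exact h (valConstOn_cls_of_residueVal (c := 0) h1 (by decide) (by decide))
    · exact h (valConstOn_cls_of_residueVal (c := 2) h1 (by decide) (by decide))
  · rintro (rfl | rfl) <;> refine ⟨by norm_num, by norm_num, ?_⟩
    · exact not_valConstOn_of_residueVal (a := 9) (b := 21) (mem_cls_iff.2 (by decide))
        (mem_cls_iff.2 (by decide)) (by decide)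
    · exact not_valConstOn_of_residueVal (a := 10) (b := 22) (mem_cls_iff.2 (by decide))
        (mem_cls_iff.2 (by decide)) (by decide)

theorem Nkm_seven_three : Nkm 7 3 = {13, 14} := by
  ext n
  simp only [Nkm, Set.mem_ofPred_eq, Set.mem_insert_iff, Set.mem_singleton_iff]
  constructor
  · rintro ⟨h1, h2, h⟩
    by_contra hne
    refine h (valConstOn_cls_of_residueVal (c := residueVal n) h1 (by decide) ?_)
    have hlt : n < 13 := by omega
    clear h h2 hne
    interval_cases n <;> decide
  · rintro (rfl | rfl) <;> refine ⟨by norm_num, by norm_num, ?_⟩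
    · exact not_valConstOn_of_dvd (a := 21) (b := 13) (t := 3) (mem_cls_iff.2 (by decide))
        (mem_cls_iff.2 (by decide)) (by decide)
    · exact not_valConstOn_of_dvd (a := 22) (b := 14) (t := 5) (mem_cls_iff.2 (by decide))
        (mem_cls_iff.2 (by decide)) (by decide)

theorem Nkm_seven_four : Nkm 7 4 = {13, 14} := by
  ext n
  simp only [Nkm, Set.mem_ofPred_eq, not_valConstOn_cls_iff le_rfl, critical_four_iff,
    Set.mem_insert_iff, Set.mem_singleton_iff]
  omega

theorem AMM_k7 :
    (∀ m, 4 ≤ m → (Nkm 7 m).ncard = 2) ∧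
    (∀ m, 4 ≤ m → ∀ n, 7 ≤ n → ¬ ValConstOn 7 (cls n (2 ^ m)) →
      Xor' (¬ ValConstOn 7 (cls n (2 ^ (m + 1))))
        (¬ ValConstOn 7 (cls (n + 2 ^ m) (2 ^ (m + 1))))) ∧
    Nkm 7 1 = {7, 8} ∧ Nkm 7 2 = {9, 10} ∧ Nkm 7 3 = {13, 14} ∧
      Nkm 7 4 = {13, 14} := by
  refine ⟨fun m hm => ncard_Nkm_seven hm, fun m hm n _ h => ?_, Nkm_seven_one, Nkm_seven_two,
    Nkm_seven_three, Nkm_seven_four⟩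
  rw [not_valConstOn_cls_iff (by omega), not_valConstOn_cls_iff (by omega)]
  exact Critical.xor_children hm ((not_valConstOn_cls_iff hm n).1 h)
end

section
/- There exists a positive integer M such that for every integer m ≥ M and every integer n ≥ 13 with n ≡ 3 (mod 4), the function j ↦ ν₂(S(j,13)) is constant on the class [n]_{2^m}. -/
/-- With `l` the residues modulo `N` of `S(n,k), S(n,k+1), …` and `a ≡ S(n,k-1)`, the residues of
`S(n+1,k), S(n+1,k+1), …` given by the recurrence. -/
def stirlingNextAux (N : ℕ) : ℕ → ℕ → List ℕ → List ℕ
  | _, _, [] => []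
  | k, a, b :: l => (k * b + a) % N :: stirlingNextAux N (k + 1) b l

/-- The map sending a row of residues of `S(n,0), S(n,1), …` to the row for `n + 1`. -/
def stirlingNext (N : ℕ) : List ℕ → List ℕ := stirlingNextAux N 0 0

/-- The residues modulo `N` of `S(n,k), …, S(n,k+len-1)`. -/
def stirlingSegment (N n k len : ℕ) : List ℕ :=
  (List.range' k len).map fun i => stirling2 n i % N

theorem stirlingNextAux_segment (N n len k : ℕ) :
    stirlingNextAux N (k + 1) (stirling2 n k % N) (stirlingSegment N n (k + 1) len) =
      stirlingSegment N (n + 1) (k + 1) len := by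
  induction len generalizing k with
  | zero => rfl
  | succ len ih =>
    have h := ih (k + 1)
    simp only [stirlingSegment] at h
    simp [stirlingSegment, List.range'_succ, stirlingNextAux, h, stirling2, Nat.add_mod,
      Nat.mul_mod]

theorem stirlingNext_segment (N n len : ℕ) :
    stirlingNext N (stirlingSegment N n 0 len) = stirlingSegment N (n + 1) 0 len := by
  cases len with
  | zero => rfl
  | succ len =>
    have h := stirlingNextAux_segment N n len 0
    simp only [stirlingSegment] at h
    simp [stirlingSegment, List.range'_succ, stirlingNext, stirlingNextAux, h, stirling2]

theorem iterate_stirlingNext_segment (N n len t : ℕ) :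
    (stirlingNext N)^[t] (stirlingSegment N n 0 len) = stirlingSegment N (n + t) 0 len := by
  induction t with
  | zero => rfl
  | succ t ih => rw [Function.iterate_succ_apply', ih, stirlingNext_segment, Nat.add_assoc]

theorem stirlingSegment_getD (N n len i : ℕ) (hi : i < len) :
    (stirlingSegment N n 0 len).getD i 0 = stirling2 n i % N := by
  simp [stirlingSegment, hi]

theorem padicValNat_two_of_mod {x e : ℕ} (h : x % 2 ^ (e + 1) = 2 ^ e) :
    padicValNat 2 x = e := by
  have hx : x = 2 ^ e * (2 * (x / 2 ^ (e + 1)) + 1) := by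
    conv_lhs => rw [← Nat.div_add_mod x (2 ^ (e + 1)), h]
    ring
  rw [hx, padicValNat.mul (by positivity) (by omega), padicValNat.prime_pow,
    padicValNat.eq_zero_of_not_dvd (by omega), add_zero]

/-- If the rows of residues modulo `64` starting from `n₀` repeat after `P` steps of length `d`, the
valuation of `S(n,13)` on the progression `n₀ + d ℕ` can be read off from one period. -/
theorem padicValNat_stirling2_of_period (n₀ d P e : ℕ) (he : e < 6) (hP : 0 < P)
    (hper : ((stirlingNext 64)^[d])^[P] ((stirlingNext 64)^[n₀] (stirlingSegment 64 0 0 14)) =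
      (stirlingNext 64)^[n₀] (stirlingSegment 64 0 0 14))
    (hval : ∀ l ∈ List.iterate (stirlingNext 64)^[d]
      ((stirlingNext 64)^[n₀] (stirlingSegment 64 0 0 14)) P,
      l.getD 13 0 % 2 ^ (e + 1) = 2 ^ e) (q : ℕ) :
    padicValNat 2 (stirling2 (n₀ + d * q) 13) = e := by
  apply padicValNat_two_of_mod
  have h := hval _ (List.mem_iterate.2 ⟨q % P, Nat.mod_lt q hP, rfl⟩)
  rw [Function.IsPeriodicPt.iterate_mod_apply hper, ← Function.iterate_mul,
    iterate_stirlingNext_segment, iterate_stirlingNext_segment, zero_add,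
    stirlingSegment_getD _ _ _ _ (by norm_num),
    show 64 = 2 ^ 6 by norm_num, Nat.mod_mod_of_dvd _ (pow_dvd_pow 2 he)] at h
  exact h

theorem padicValNat_stirling2_thirteen_of_mod_eight_eq_seven {n : ℕ} (hn : 16 ≤ n)
    (h : n % 8 = 7) : padicValNat 2 (stirling2 n 13) = 1 := by
  obtain ⟨q, rfl⟩ : ∃ q, n = 23 + 8 * q := ⟨(n - 23) / 8, by omega⟩
  exact padicValNat_stirling2_of_period 23 8 32 1 (by norm_num) (by norm_num)
    (by decide +kernel) (by decide +kernel) q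

theorem padicValNat_stirling2_thirteen_of_mod_sixteen_eq_three {n : ℕ} (hn : 16 ≤ n)
    (h : n % 16 = 3) : padicValNat 2 (stirling2 n 13) = 3 := by
  obtain ⟨q, rfl⟩ : ∃ q, n = 19 + 16 * q := ⟨(n - 19) / 16, by omega⟩
  exact padicValNat_stirling2_of_period 19 16 16 3 (by norm_num) (by norm_num)
    (by decide +kernel) (by decide +kernel) q

theorem padicValNat_stirling2_thirteen_of_mod_sixteen_eq_eleven {n : ℕ} (hn : 16 ≤ n)
    (h : n % 16 = 11) : padicValNat 2 (stirling2 n 13) = 5 := by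
  obtain ⟨q, rfl⟩ : ∃ q, n = 27 + 16 * q := ⟨(n - 27) / 16, by omega⟩
  exact padicValNat_stirling2_of_period 27 16 16 5 (by norm_num) (by norm_num)
    (by decide +kernel) (by decide +kernel) q

theorem k13_const_on_3_mod_4 :
    ∃ M : ℕ, 0 < M ∧ ∀ m, M ≤ m → ∀ n, 13 ≤ n → n % 4 = 3 →
      ValConstOn 13 (cls n (2 ^ m)) := by
  refine ⟨4, by norm_num, fun m hm n _ hn i hi j hj => ?_⟩
  have hdvd : 16 ∣ 2 ^ m := pow_dvd_pow 2 hm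
  have hle : 16 ≤ 2 ^ m := Nat.le_of_dvd (by positivity) hdvd
  have hi16 : 16 ≤ i := hle.trans ((le_max_right _ _).trans hi.1)
  have hj16 : 16 ≤ j := hle.trans ((le_max_right _ _).trans hj.1)
  have hin : i % 16 = n % 16 := hi.2.of_dvd hdvd
  have hjn : j % 16 = n % 16 := hj.2.of_dvd hdvd
  obtain h | h | h : n % 8 = 7 ∨ n % 16 = 3 ∨ n % 16 = 11 := by omega
  · rw [padicValNat_stirling2_thirteen_of_mod_eight_eq_seven hi16 (by omega),
      padicValNat_stirling2_thirteen_of_mod_eight_eq_seven hj16 (by omega)]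
  · rw [padicValNat_stirling2_thirteen_of_mod_sixteen_eq_three hi16 (by omega),
      padicValNat_stirling2_thirteen_of_mod_sixteen_eq_three hj16 (by omega)]
  · rw [padicValNat_stirling2_thirteen_of_mod_sixteen_eq_eleven hi16 (by omega),
      padicValNat_stirling2_thirteen_of_mod_sixteen_eq_eleven hj16 (by omega)]
end
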